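/- Let P have a density h w.r.t. Lebesgue measure on ℝ^d given by a finite hypercube-wise constant function: P = Σ_{i=1}^m sᵢ U(Cᵢ) with pairwise disjoint hypercubes Cᵢ of common edge length l and weights sᵢ > 0 summing to 1. Then with nᵢ = ⌊tᵢ n⌋, tᵢ = sᵢ^{d/(d+p)}/Σⱼ sⱼ^{d/(d+p)}, one has limsup_{n→∞} n^{p/d} d_{n,p}(P)^p ≤ (Q^{dq})^p · l^p · (Σ_{i=1}^m sᵢ^{d/(d+p)})^{(d+p)/d} = (Q^{dq})^p · ‖h‖_{d/(d+p)}, where Q^{dq} = lim_n n^{1/d} d_{n,p}(U([0,1]^d)) and ‖h‖_{d/(d+p)} = (∫ h^{d/(d+p)} dλ^d)^{(d+p)/d}. -/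

import Mathlib

open MeasureTheory ENNReal Filter

noncomputable section

def Fppow {E : Type*} [NormedAddCommGroup E] [NormedSpace ℝ E]
    (p : ℝ) (Γ : Finset E) (ξ : E) : ℝ≥0∞ :=
  sInf { c | ∃ w : E → ℝ, (∀ x ∈ Γ, 0 ≤ w x) ∧ (∀ x ∈ Γ, w x ≤ 1) ∧
    (∑ x ∈ Γ, w x) = 1 ∧ (∑ x ∈ Γ, w x • x) = ξ ∧
    c = ENNReal.ofReal (∑ x ∈ Γ, w x * ‖ξ - x‖ ^ p) }

def dnpPow {E : Type*} [NormedAddCommGroup E] [NormedSpace ℝ E]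
    [MeasurableSpace E] (n : ℕ) (p : ℝ) (P : Measure E) : ℝ≥0∞ :=
  ⨅ (Γ : Finset E) (_ : Γ.card ≤ n), ∫⁻ ξ, Fppow p Γ ξ ∂P

def unif {d : ℕ} (s : Set (Fin d → ℝ)) : Measure (Fin d → ℝ) :=
  (volume s)⁻¹ • volume.restrict s

/-- `(Q^{dq}_{‖·‖,p,d})^p = inf_n n^{p/d} d_{n,p}^p(U([0,1]^d))`. -/
def QdqPow (d : ℕ) (p : ℝ) : ℝ≥0∞ :=
  ⨅ n : ℕ, ((n + 1 : ℕ) : ℝ≥0∞) ^ (p / d) *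
    dnpPow (n + 1) p (unif (Set.Icc (0 : Fin d → ℝ) 1))

section Helpers

theorem Fppow_anti {E : Type*} [NormedAddCommGroup E] [NormedSpace ℝ E]
    (p : ℝ) {Γ Γ' : Finset E} (h : Γ ⊆ Γ') (ξ : E) : Fppow p Γ' ξ ≤ Fppow p Γ ξ := by
  classical
  apply le_sInf
  rintro c ⟨w, h0, h1, hs, hx, rfl⟩
  apply sInf_le
  refine ⟨fun x => if x ∈ Γ then w x else 0, ?_, ?_, ?_, ?_, ?_⟩
  · intro x _
    by_cases hx : x ∈ Γ <;> simp [hx, h0]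
  · intro x _
    by_cases hx : x ∈ Γ <;> simp [hx, h1]
  · rw [← Finset.sum_subset h (fun x _ hx => by simp [hx]), ← hs]
    exact Finset.sum_congr rfl (fun x hx => by simp [hx])
  · rw [← Finset.sum_subset h (fun x _ hx => by simp [hx])]
    refine Eq.trans ?_ hx
    exact Finset.sum_congr rfl (fun x hx => by simp [hx])
  · rw [← Finset.sum_subset h (fun x _ hx => by simp [hx])]
    congr 1
    exact Finset.sum_congr rfl (fun x hx => by simp [hx])

variable {E : Type*} [NormedAddCommGroup E] [NormedSpace ℝ E]

theorem dnpPow_le [MeasurableSpace E] {n : ℕ} {p : ℝ} {P : Measure E} (Γ : Finset E)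
    (h : Γ.card ≤ n) : dnpPow n p P ≤ ∫⁻ ξ, Fppow p Γ ξ ∂P :=
  iInf₂_le Γ h

theorem dnpPow_anti [MeasurableSpace E] {n k : ℕ} (h : k ≤ n) (p : ℝ) (P : Measure E) :
    dnpPow n p P ≤ dnpPow k p P :=
  le_iInf₂ fun Γ hΓ => dnpPow_le Γ (hΓ.trans h)

theorem dnpPow_mono [MeasurableSpace E] (n : ℕ) (p : ℝ) {P Q : Measure E} (h : P ≤ Q) :
    dnpPow n p P ≤ dnpPow n p Q :=
  le_iInf₂ fun Γ hΓ => (dnpPow_le Γ hΓ).trans (lintegral_mono' h le_rfl)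

theorem dnpPow_smul [MeasurableSpace E] (n : ℕ) (p : ℝ) (P : Measure E) {c : ℝ≥0∞}
    (hc : c ≠ 0) (hc' : c ≠ ⊤) : dnpPow n p (c • P) ≤ c * dnpPow n p P := by
  unfold dnpPow
  simp only [ENNReal.mul_iInf_of_ne hc hc', lintegral_smul_measure, smul_eq_mul]
  exact le_rfl

theorem dnpPow_add [MeasurableSpace E] (n k : ℕ) (p : ℝ) (P Q : Measure E) :
    dnpPow (n + k) p (P + Q) ≤ dnpPow n p P + dnpPow k p Q := by
  classical
  refine ENNReal.le_of_forall_pos_le_add ?_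
  intro ε hε hfin
  obtain ⟨hP, hQ⟩ := ENNReal.add_lt_top.1 hfin
  have hε2 : (ε / 2 : ℝ≥0∞) ≠ 0 := by
    simp [hε.ne']
  have h1 := ENNReal.lt_add_right hP.ne hε2
  have h2 := ENNReal.lt_add_right hQ.ne hε2
  conv_lhs at h1 => unfold dnpPow
  conv_lhs at h2 => unfold dnpPow
  simp only [iInf_lt_iff] at h1 h2
  obtain ⟨Γ, hΓ, h1⟩ := h1
  obtain ⟨Δ, hΔ, h2⟩ := h2
  refine (dnpPow_le (Γ ∪ Δ) ((Finset.card_union_le _ _).trans (add_le_add hΓ hΔ))).trans ?_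
  rw [lintegral_add_measure]
  calc _ ≤ (∫⁻ ξ, Fppow p Γ ξ ∂P) + ∫⁻ ξ, Fppow p Δ ξ ∂Q :=
        add_le_add (lintegral_mono fun ξ => Fppow_anti p Finset.subset_union_left ξ)
          (lintegral_mono fun ξ => Fppow_anti p Finset.subset_union_right ξ)
    _ ≤ (dnpPow n p P + ε / 2) + (dnpPow k p Q + ε / 2) := add_le_add h1.le h2.le
    _ = dnpPow n p P + dnpPow k p Q + (ε / 2 + ε / 2) := by ring
    _ = _ := by rw [ENNReal.add_halves]

theorem dnpPow_sum [MeasurableSpace E] {ι : Type*} (t : Finset ι) (n : ι → ℕ) (p : ℝ)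
    (P : ι → Measure E) :
    dnpPow (∑ i ∈ t, n i) p (∑ i ∈ t, P i) ≤ ∑ i ∈ t, dnpPow (n i) p (P i) := by
  classical
  induction t using Finset.induction_on with
  | empty =>
    simp only [Finset.sum_empty]
    exact (dnpPow_le ∅ (by simp)).trans (by simp)
  | insert i t hi ih =>
    rw [Finset.sum_insert hi, Finset.sum_insert hi, Finset.sum_insert hi]
    exact (dnpPow_add _ _ _ _ _).trans (add_le_add le_rfl ih)

theorem Fppow_affine (p : ℝ) {r : ℝ} (hr : 0 < r) (a : E) (Γ : Finset E) (ξ : E)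
    (f : E ↪ E) (hf : ∀ x, f x = a + r • x) :
    Fppow p (Γ.map f) (f ξ) ≤ ENNReal.ofReal (r ^ p) * Fppow p Γ ξ := by
  have hrp : 0 < r ^ p := Real.rpow_pos_of_pos hr p
  unfold Fppow
  rw [sInf_eq_iInf, sInf_eq_iInf]
  simp only [ENNReal.mul_iInf_of_ne (ENNReal.ofReal_pos.2 hrp).ne' ENNReal.ofReal_ne_top]
  refine le_iInf₂ ?_
  rintro c ⟨w, h0, h1, hs, hx, rfl⟩
  have hw : ∀ x, w (r⁻¹ • (f x - a)) = w x := by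
    intro x
    rw [hf, add_sub_cancel_left, smul_smul, inv_mul_cancel₀ hr.ne', one_smul]
  refine iInf₂_le _ ⟨fun y => w (r⁻¹ • (y - a)), ?_, ?_, ?_, ?_, ?_⟩
  · simpa [hw] using h0
  · simpa [hw] using h1
  · simpa [hw] using hs
  · rw [Finset.sum_map]
    simp only [hw]
    simp only [hf, smul_add, Finset.sum_add_distrib, ← Finset.sum_smul, hs, one_smul]
    rw [← hx, Finset.smul_sum]
    congr 1
    exact Finset.sum_congr rfl fun x _ => smul_comm _ _ _
  · rw [Finset.sum_map, ← ENNReal.ofReal_mul hrp.le, Finset.mul_sum]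
    congr 1
    refine Finset.sum_congr rfl fun x _ => ?_
    simp only [hw]
    rw [hf, hf, add_sub_add_left_eq_sub, ← smul_sub, norm_smul,
      Real.mul_rpow (norm_nonneg _) (norm_nonneg _), Real.norm_of_nonneg hr.le]
    ring

theorem volume_cube {d : ℕ} (a : Fin d → ℝ) {l : ℝ} (hl : 0 < l) :
    volume (Set.Icc a (a + l • (1 : Fin d → ℝ))) = ENNReal.ofReal (l ^ d) := by
  rw [Real.volume_Icc_pi]
  simp [ENNReal.ofReal_pow hl.le]

theorem unif_cube {d : ℕ} (a : Fin d → ℝ) {l : ℝ} (hl : 0 < l) :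
    unif (Set.Icc a (a + l • (1 : Fin d → ℝ))) =
      Measure.map ((Homeomorph.smulOfNeZero l hl.ne').trans
        (Homeomorph.addLeft a)).toMeasurableEquiv (unif (Set.Icc (0 : Fin d → ℝ) 1)) := by
  set e := ((Homeomorph.smulOfNeZero l hl.ne').trans
        (Homeomorph.addLeft a)).toMeasurableEquiv with he
  have hev : ∀ x, e x = a + l • x := fun x => rfl
  have hpre : e ⁻¹' (Set.Icc a (a + l • (1 : Fin d → ℝ))) = Set.Icc 0 1 := by
    ext x
    simp [hev, Pi.le_def, hl]
  have hmap : Measure.map e (volume : Measure (Fin d → ℝ)) =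
      (ENNReal.ofReal (l ^ d))⁻¹ • volume := by
    have : (e : (Fin d → ℝ) → (Fin d → ℝ)) = (fun x => a + x) ∘ (fun x => l • x) := rfl
    rw [this, ← Measure.map_map (by fun_prop) (by fun_prop), Measure.map_addHaar_smul _ hl.ne',
      Measure.map_smul, map_add_left_eq_self]
    congr 1
    rw [Module.finrank_fin_fun, abs_of_pos (by positivity), ENNReal.ofReal_inv_of_pos (by positivity)]
  have h1 : volume (Set.Icc (0 : Fin d → ℝ) 1) = 1 := by
    have := volume_cube (0 : Fin d → ℝ) one_pos
    simpa using this
  unfold unif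
  rw [volume_cube a hl, h1, inv_one, one_smul, ← hpre, ← e.restrict_map, hmap,
    Measure.restrict_smul]

theorem dnpPow_cube {d : ℕ} (n : ℕ) (p : ℝ) (a : Fin d → ℝ) {l : ℝ} (hl : 0 < l) :
    dnpPow n p (unif (Set.Icc a (a + l • (1 : Fin d → ℝ)))) ≤
      ENNReal.ofReal (l ^ p) * dnpPow n p (unif (Set.Icc (0 : Fin d → ℝ) 1)) := by
  have hrp : 0 < l ^ p := Real.rpow_pos_of_pos hl p
  conv_rhs => unfold dnpPow
  simp only [ENNReal.mul_iInf_of_ne (ENNReal.ofReal_pos.2 hrp).ne' ENNReal.ofReal_ne_top]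
  refine le_iInf₂ fun Γ hΓ => ?_
  rw [unif_cube a hl]
  set e := ((Homeomorph.smulOfNeZero l hl.ne').trans
        (Homeomorph.addLeft a)).toMeasurableEquiv with he
  have hev : ∀ x, e x = a + l • x := fun x => rfl
  refine (dnpPow_le (Γ.map e.toEquiv.toEmbedding) (by simpa using hΓ)).trans ?_
  rw [lintegral_map_equiv, ← lintegral_const_mul' _ _ ENNReal.ofReal_ne_top]
  exact lintegral_mono fun ξ => Fppow_affine p hl a Γ ξ e.toEquiv.toEmbedding hev

theorem unif_le_sum {d : ℕ} {k : ℕ} (hk : 0 < k) :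
    unif (Set.Icc (0 : Fin d → ℝ) 1) ≤ ∑ j : Fin d → Fin k,
      ENNReal.ofReal (((k : ℝ)⁻¹) ^ d) •
        unif (Set.Icc (fun i => (j i : ℝ) / k)
          ((fun i => (j i : ℝ) / k) + (k : ℝ)⁻¹ • (1 : Fin d → ℝ))) := by
  have hk' : (0 : ℝ) < k := by exact_mod_cast hk
  have h1 : volume (Set.Icc (0 : Fin d → ℝ) 1) = 1 := by
    have := volume_cube (0 : Fin d → ℝ) one_pos
    simpa using this
  have hpos : 0 < ((k : ℝ)⁻¹) ^ d := by positivity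
  simp only [unif, volume_cube _ (inv_pos.2 hk'), h1, inv_one, one_smul, smul_smul,
    ENNReal.mul_inv_cancel (ENNReal.ofReal_pos.2 hpos).ne' ENNReal.ofReal_ne_top]
  rw [← Measure.sum_fintype]
  refine le_trans (Measure.restrict_mono ?_ le_rfl) Measure.restrict_iUnion_le
  intro x hx
  rw [Set.mem_iUnion]
  have hx0 : ∀ i, 0 ≤ x i := fun i => hx.1 i
  have hx1 : ∀ i, x i ≤ 1 := fun i => hx.2 i
  have hex : ∀ i, ∃ j : Fin k, (j : ℝ) / k ≤ x i ∧ x i ≤ (j : ℝ) / k + (k : ℝ)⁻¹ := by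
    intro i
    have hadd : ∀ y : ℝ, y / k + (k : ℝ)⁻¹ = (y + 1) / k := fun y => by field_simp
    simp only [hadd, div_le_iff₀ hk', le_div_iff₀ hk']
    rcases (hx1 i).lt_or_eq with h | h
    · refine ⟨⟨⌊x i * k⌋₊, ?_⟩, ?_, ?_⟩
      · rw [Nat.floor_lt (mul_nonneg (hx0 i) hk'.le)]
        nlinarith
      · exact Nat.floor_le (mul_nonneg (hx0 i) hk'.le)
      · exact (Nat.lt_floor_add_one _).le
    · refine ⟨⟨k - 1, by omega⟩, ?_, ?_⟩
      · simp only [h, one_mul]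
        exact_mod_cast Nat.sub_le _ _
      · simp only [h, one_mul]
        have : k ≤ (k - 1) + 1 := by omega
        exact_mod_cast this
  choose j hj using hex
  refine ⟨j, fun i => (hj i).1, fun i => ?_⟩
  simpa using (hj i).2

theorem dnpPow_tile {d : ℕ} {k : ℕ} (hk : 0 < k) (N : ℕ) (p : ℝ) :
    dnpPow (k ^ d * N) p (unif (Set.Icc (0 : Fin d → ℝ) 1)) ≤
      ENNReal.ofReal (((k : ℝ)⁻¹) ^ p) * dnpPow N p (unif (Set.Icc (0 : Fin d → ℝ) 1)) := by
  have hk' : (0 : ℝ) < k := by exact_mod_cast hk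
  have hpos : 0 < ((k : ℝ)⁻¹) ^ d := by positivity
  refine (dnpPow_mono _ _ (unif_le_sum hk)).trans ?_
  have hc : k ^ d * N = ∑ j : Fin d → Fin k, N := by simp
  rw [hc]
  refine (dnpPow_sum _ _ _ _).trans ?_
  refine (Finset.sum_le_sum fun j _ => (dnpPow_smul _ _ _ (ENNReal.ofReal_pos.2 hpos).ne'
    ENNReal.ofReal_ne_top).trans (mul_le_mul_right (dnpPow_cube _ _ _ (inv_pos.2 hk')) _)).trans ?_
  rw [Finset.sum_const, Finset.card_univ, nsmul_eq_mul, ← mul_assoc]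
  have : ((Fintype.card (Fin d → Fin k) : ℕ) : ℝ≥0∞) * ENNReal.ofReal (((k : ℝ)⁻¹) ^ d) = 1 := by
    rw [← ENNReal.ofReal_natCast, ← ENNReal.ofReal_mul (by positivity)]
    simp [← mul_pow, hk'.ne']
  rw [this, one_mul]

end Helpers

theorem limsup_aux (d : ℕ) (hd : 1 ≤ d) (p : ℝ) (hp : 1 ≤ p)
    (m : ℕ) (hm : 1 ≤ m) (s : Fin m → ℝ) (hs : ∀ i, 0 < s i)
    (l : ℝ) (hl : 0 < l) (a : Fin m → (Fin d → ℝ))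
    (P : Measure (Fin d → ℝ))
    (hP : P = ∑ i, ENNReal.ofReal (s i) •
        unif (Set.Icc (a i) (a i + l • (1 : Fin d → ℝ)))) (N : ℕ) (hN : 0 < N)
    (hfin : dnpPow N p (unif (Set.Icc (0 : Fin d → ℝ) 1)) ≠ ⊤) :
    Filter.limsup (fun n : ℕ => (n : ℝ≥0∞) ^ (p / d) * dnpPow n p P) atTop ≤
      (N : ℝ≥0∞) ^ (p / d) * dnpPow N p (unif (Set.Icc (0 : Fin d → ℝ) 1)) *
        ENNReal.ofReal (l ^ p * (∑ i, s i ^ ((d : ℝ) / (d + p))) ^ ((d + p) / d)) := by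
  set D := dnpPow N p (unif (Set.Icc (0 : Fin d → ℝ) 1)) with hD
  set S := ∑ i, s i ^ ((d : ℝ) / (d + p)) with hS
  have hd' : (0 : ℝ) < d := by exact_mod_cast hd
  have hp' : 0 < p := by linarith
  have hN' : (0 : ℝ) < N := by exact_mod_cast hN
  haveI : Nonempty (Fin m) := ⟨⟨0, hm⟩⟩
  have hSpos : 0 < S := Finset.sum_pos (fun i _ => Real.rpow_pos_of_pos (hs i) _)
    Finset.univ_nonempty
  set t : Fin m → ℝ := fun i => s i ^ ((d : ℝ) / (d + p)) / S with ht
  have htpos : ∀ i, 0 < t i := fun i => div_pos (Real.rpow_pos_of_pos (hs i) _) hSpos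
  have htsum : ∑ i, t i = 1 := by
    rw [ht, ← Finset.sum_div, ← hS, div_self hSpos.ne']
  set c : Fin m → ℝ := fun i => (t i / N) ^ ((1 : ℝ) / d) with hc
  have hcpos : ∀ i, 0 < c i := fun i => Real.rpow_pos_of_pos (div_pos (htpos i) hN') _
  set x : ℕ → ℝ := fun n => (n : ℝ) ^ ((1 : ℝ) / d) with hx
  have hx0 : ∀ n, 0 ≤ x n := fun n => Real.rpow_nonneg (Nat.cast_nonneg n) _
  have hxtop : Tendsto x atTop atTop :=
    (tendsto_rpow_atTop (by positivity)).comp tendsto_natCast_atTop_atTop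
  set k : Fin m → ℕ → ℕ := fun i n => ⌊c i * x n⌋₊ with hk
  have hktop : ∀ i, ∀ᶠ n in atTop, 0 < k i n := by
    intro i
    have : Tendsto (k i) atTop atTop :=
      tendsto_nat_floor_atTop.comp (hxtop.const_mul_atTop (hcpos i))
    exact this.eventually_gt_atTop 0
  have hkle : ∀ i n, ((k i n : ℝ)) ^ d * N ≤ t i * n := by
    intro i n
    have h1 : (k i n : ℝ) ≤ c i * x n := Nat.floor_le (mul_nonneg (hcpos i).le (hx0 n))
    have h2 : (k i n : ℝ) ^ d ≤ (c i * x n) ^ d := by gcongr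
    have h3 : (c i * x n) ^ d = t i / N * n := by
      rw [mul_pow, hc, hx]
      simp only
      rw [← Real.rpow_natCast, ← Real.rpow_natCast, ← Real.rpow_mul (div_pos (htpos i) hN').le,
        ← Real.rpow_mul (Nat.cast_nonneg n), one_div_mul_cancel hd'.ne', Real.rpow_one,
        Real.rpow_one]
    rw [h3] at h2
    calc _ ≤ t i / N * n * N := by gcongr
      _ = _ := by field_simp
  have hksum : ∀ n, ∑ i, (k i n) ^ d * N ≤ n := by
    intro n
    have : ∑ i, ((k i n : ℝ)) ^ d * N ≤ n := by
      refine (Finset.sum_le_sum fun i _ => hkle i n).trans ?_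
      rw [← Finset.sum_mul, htsum, one_mul]
    exact_mod_cast this
  set g : ℕ → ℝ := fun n => ∑ i, s i * l ^ p * (x n / k i n) ^ p with hg
  have hbound : ∀ᶠ n : ℕ in atTop, (n : ℝ≥0∞) ^ (p / d) * dnpPow n p P ≤
      ENNReal.ofReal (g n) * D := by
    filter_upwards [Filter.eventually_all.2 hktop] with n hn
    have h1 : dnpPow n p P ≤ ∑ i, ENNReal.ofReal (s i) * (ENNReal.ofReal (l ^ p) *
        (ENNReal.ofReal (((k i n : ℝ)⁻¹) ^ p) * D)) := by
      rw [hP]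
      refine (dnpPow_anti (hksum n) _ _).trans ((dnpPow_sum _ _ _ _).trans ?_)
      refine Finset.sum_le_sum fun i _ => ?_
      refine (dnpPow_smul _ _ _ (ENNReal.ofReal_pos.2 (hs i)).ne' ENNReal.ofReal_ne_top).trans ?_
      refine mul_le_mul_right ((dnpPow_cube _ _ _ hl).trans ?_) _
      exact mul_le_mul_right (dnpPow_tile (hn i) _ _) _
    have h2 : (n : ℝ≥0∞) ^ (p / d) = ENNReal.ofReal (x n ^ p) := by
      rw [← ENNReal.ofReal_natCast, ENNReal.ofReal_rpow_of_nonneg (Nat.cast_nonneg n)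
        (by positivity), hx]
      simp only
      rw [← Real.rpow_mul (Nat.cast_nonneg n)]
      congr 2
      ring
    refine (mul_le_mul_right h1 _).trans (le_of_eq ?_)
    rw [h2, hg, ENNReal.ofReal_sum_of_nonneg, Finset.mul_sum, Finset.sum_mul]
    · refine Finset.sum_congr rfl fun i _ => ?_
      rw [← mul_assoc, ← mul_assoc, ← mul_assoc, ← ENNReal.ofReal_mul, ← ENNReal.ofReal_mul,
        ← ENNReal.ofReal_mul]
      · congr 2
        rw [div_eq_mul_inv, Real.mul_rpow (hx0 n) (by positivity)]
        ring
      · have := hx0 n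
        have := hs i
        positivity
      · have := hx0 n
        have := hs i
        positivity
      · have := hx0 n
        positivity
    · intro i _
      have := hx0 n
      have := hs i
      positivity
  have hlim : Tendsto g atTop (nhds (∑ i, s i * l ^ p * ((c i)⁻¹) ^ p)) := by
    refine tendsto_finsetSum _ fun i _ => ?_
    refine Tendsto.const_mul _ (Tendsto.rpow_const ?_ (Or.inr hp'.le))
    have h1 : Tendsto (fun n => (⌊c i * x n⌋₊ : ℝ) / x n) atTop (nhds (c i)) :=
      (tendsto_nat_floor_mul_div_atTop (hcpos i).le).comp hxtop
    refine (h1.inv₀ (hcpos i).ne').congr fun n => ?_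
    rw [inv_div]
  have hval : ∑ i, s i * l ^ p * ((c i)⁻¹) ^ p =
      (N : ℝ) ^ (p / d) * (l ^ p * S ^ ((d + p) / d)) := by
    have hterm : ∀ i, s i * l ^ p * ((c i)⁻¹) ^ p =
        (N : ℝ) ^ (p / d) * l ^ p * S ^ (p / d) * s i ^ ((d : ℝ) / (d + p)) := by
      intro i
      have hsi := hs i
      have e1 : ((c i)⁻¹) ^ p = (N : ℝ) ^ (p / d) * S ^ (p / d) * (s i ^ (p / (d + p)))⁻¹ := by
        rw [hc]
        simp only
        rw [← Real.inv_rpow (div_pos (htpos i) hN').le, ← Real.rpow_mul (by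
          have := htpos i
          positivity), inv_div, ht]
        simp only
        have : (N : ℝ) / (s i ^ ((d : ℝ) / (d + p)) / S) =
          (N * S) / (s i ^ ((d : ℝ) / (d + p))) := by
          field_simp
        rw [this, Real.div_rpow (by positivity) (by positivity), Real.mul_rpow hN'.le hSpos.le,
          ← Real.rpow_mul hsi.le, one_div_mul_eq_div, div_eq_mul_inv]
        congr 3
        field_simp
      have e2 : s i * (s i ^ (p / (d + p)))⁻¹ = s i ^ ((d : ℝ) / (d + p)) := by
        rw [← Real.rpow_neg hsi.le]
        nth_rewrite 1 [← Real.rpow_one (s i)]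
        rw [← Real.rpow_add hsi]
        congr 1
        field_simp
        ring
      rw [e1, ← e2]
      ring
    simp only [hterm]
    rw [← Finset.mul_sum, ← hS]
    have : S ^ (((d : ℝ) + p) / d) = S ^ (p / d) * S := by
      rw [add_div, div_self hd'.ne', add_comm, Real.rpow_add hSpos, Real.rpow_one]
    rw [this]
    ring
  have hT : Tendsto (fun n => ENNReal.ofReal (g n) * D) atTop
      (nhds (ENNReal.ofReal (∑ i, s i * l ^ p * ((c i)⁻¹) ^ p) * D)) :=
    ENNReal.Tendsto.mul_const (ENNReal.tendsto_ofReal hlim) (Or.inr hfin)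
  refine (limsup_le_limsup hbound).trans ?_
  rw [hT.limsup_eq, hval, ENNReal.ofReal_mul (by positivity),
    ← ENNReal.ofReal_rpow_of_nonneg hN'.le (by positivity), ENNReal.ofReal_natCast]
  exact le_of_eq (by ring)

/-- for a hypercube-wise uniform mixture
`P = Σᵢ sᵢ U(Cᵢ)` over pairwise disjoint hypercubes of common edge length `l`,
`limsup_n n^{p/d} d_{n,p}^p(P) ≤ (Q^{dq})^p l^p (Σᵢ sᵢ^{d/(d+p)})^{(d+p)/d}
  = (Q^{dq})^p ‖h‖_{d/(d+p)}`. -/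
theorem limsup_dnpPow_cubewise (d : ℕ) (hd : 1 ≤ d) (p : ℝ) (hp : 1 ≤ p)
    (m : ℕ) (hm : 1 ≤ m) (s : Fin m → ℝ) (hs : ∀ i, 0 < s i)
    (hsum : ∑ i, s i = 1) (l : ℝ) (hl : 0 < l) (a : Fin m → (Fin d → ℝ))
    (hdisj : Pairwise (Function.onFun Disjoint
      (fun i => Set.Icc (a i) (a i + l • (1 : Fin d → ℝ)))))
    (P : Measure (Fin d → ℝ))
    (hP : P = ∑ i, ENNReal.ofReal (s i) •
        unif (Set.Icc (a i) (a i + l • (1 : Fin d → ℝ)))) :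
    Filter.limsup (fun n : ℕ => (n : ℝ≥0∞) ^ (p / d) * dnpPow n p P) atTop ≤
      QdqPow d p *
        ENNReal.ofReal (l ^ p * (∑ i, s i ^ ((d : ℝ) / (d + p))) ^ ((d + p) / d)) := by
  have hSpos : 0 < ∑ i, s i ^ ((d : ℝ) / (d + p)) :=
    Finset.sum_pos (fun i _ => Real.rpow_pos_of_pos (hs i) _) ⟨⟨0, hm⟩, Finset.mem_univ _⟩
  have hCpos : 0 < l ^ p * (∑ i, s i ^ ((d : ℝ) / (d + p))) ^ ((d + p) / d) :=
    mul_pos (Real.rpow_pos_of_pos hl _) (Real.rpow_pos_of_pos hSpos _)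
  unfold QdqPow
  rw [ENNReal.iInf_mul_of_ne (ENNReal.ofReal_pos.2 hCpos).ne' ENNReal.ofReal_ne_top]
  refine le_iInf fun N => ?_
  by_cases hfin : dnpPow (N + 1) p (unif (Set.Icc (0 : Fin d → ℝ) 1)) = ⊤
  · have h1 : ((N + 1 : ℕ) : ℝ≥0∞) ^ (p / d) ≠ 0 := by
      refine (ENNReal.rpow_pos ?_ (ENNReal.natCast_ne_top _)).ne'
      exact_mod_cast Nat.succ_pos N
    rw [hfin, ENNReal.mul_top h1, ENNReal.top_mul (ENNReal.ofReal_pos.2 hCpos).ne']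
    exact le_top
  · exact limsup_aux d hd p hp m hm s hs l hl a P hP (N + 1) (Nat.succ_pos N) hfin

end
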